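/- Let d ≥ 1, ω = exp(2πi/d), and let t : (ZMod d)⁴ → ℂ be given by t(i,j,k,l) = d^{-1/2}·ω^{i·l} if j = i + k and 0 otherwise. Define the orthonormal vectors |ĩ⟩ = d^{-1/2} ∑_{j,k,l} t(i,j,k,l) |j⟩⊗|k⟩⊗|l⟩ ∈ (ℂ^{ZMod d})^{⊗3}, i ∈ ZMod d. Then every density matrix ρ̃ supported in span{|ĩ⟩} satisfies both: (i) I(R:P3)(ρ̃) := S(ρ̃) + S(ρ̃^{P3}) − S(ρ̃^{P1P2}) ≤ log d, and (ii) −2 S(ρ̃) ≤ I₃(P1:P2:P3)(ρ̃) ≤ −2 S(ρ̃) + log d. -/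

import Mathlib

open Matrix MeasureTheory ProbabilityTheory
open scoped ComplexOrder BigOperators

noncomputable section

/-- von Neumann entropy (natural logarithm), via the eigenvalues of a Hermitian matrix;
`Real.log 0 = 0` implements the convention `0 · log 0 = 0`. -/
def vN {n : Type*} [Fintype n] [DecidableEq n] (ρ : Matrix n n ℂ) : ℝ :=
  if h : ρ.IsHermitian then -∑ k, h.eigenvalues k * Real.log (h.eigenvalues k) else 0

/-- `ρ` is a density matrix: positive semidefinite with unit trace. -/
def IsDensity {n : Type*} [Fintype n] [DecidableEq n] (ρ : Matrix n n ℂ) : Prop :=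
  ρ.PosSemidef ∧ ρ.trace = 1

section reds
variable {α β γ : Type*} [Fintype α] [Fintype β] [Fintype γ]

/-- reduced density on party 1 (partial trace over parties 2, 3) -/
def red1 (ρ : Matrix (α × β × γ) (α × β × γ) ℂ) : Matrix α α ℂ :=
  Matrix.of fun a a' => ∑ b, ∑ c, ρ (a, b, c) (a', b, c)
/-- reduced density on party 2 -/
def red2 (ρ : Matrix (α × β × γ) (α × β × γ) ℂ) : Matrix β β ℂ :=
  Matrix.of fun b b' => ∑ a, ∑ c, ρ (a, b, c) (a, b', c)
/-- reduced density on party 3 -/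
def red3 (ρ : Matrix (α × β × γ) (α × β × γ) ℂ) : Matrix γ γ ℂ :=
  Matrix.of fun c c' => ∑ a, ∑ b, ρ (a, b, c) (a, b, c')
/-- reduced density on parties 1, 2 (partial trace over party 3) -/
def red12 (ρ : Matrix (α × β × γ) (α × β × γ) ℂ) : Matrix (α × β) (α × β) ℂ :=
  Matrix.of fun x y => ∑ c, ρ (x.1, x.2, c) (y.1, y.2, c)
/-- reduced density on parties 1, 3 -/
def red13 (ρ : Matrix (α × β × γ) (α × β × γ) ℂ) : Matrix (α × γ) (α × γ) ℂ :=
  Matrix.of fun x y => ∑ b, ρ (x.1, b, x.2) (y.1, b, y.2)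
/-- reduced density on parties 2, 3 -/
def red23 (ρ : Matrix (α × β × γ) (α × β × γ) ℂ) : Matrix (β × γ) (β × γ) ℂ :=
  Matrix.of fun x y => ∑ a, ρ (a, x.1, x.2) (a, y.1, y.2)

/-- tripartite information I₃(P1:P2:P3) -/
def I3 [DecidableEq α] [DecidableEq β] [DecidableEq γ]
    (ρ : Matrix (α × β × γ) (α × β × γ) ℂ) : ℝ :=
  vN (red1 ρ) + vN (red2 ρ) + vN (red3 ρ)
    - vN (red12 ρ) - vN (red13 ρ) - vN (red23 ρ) + vN ρ
end reds

/-- rank-one operator |v⟩⟨w| -/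
def outer {X : Type*} (v w : X → ℂ) : Matrix X X ℂ :=
  Matrix.of fun x y => v x * star (w y)

/-- orthonormal family of vectors -/
def ONFam {ι X : Type*} [DecidableEq ι] [Fintype X] (v : ι → X → ℂ) : Prop :=
  ∀ i j, (∑ x, star (v i x) * v j x) = if i = j then (1 : ℂ) else 0

/-- the support (range) of `ρ` is contained in the span of the family `v` -/
def SuppIn {ι X : Type*} [Fintype X] (ρ : Matrix X X ℂ) (v : ι → X → ℂ) : Prop :=
  LinearMap.range ρ.mulVecLin ≤ Submodule.span ℂ (Set.range v)

/-- a (rectangular) matrix is unitary -/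
def IsUnitaryM {A B : Type*} [Fintype A] [Fintype B] [DecidableEq A] [DecidableEq B]
    (U : Matrix A B ℂ) : Prop :=
  U * Uᴴ = 1 ∧ Uᴴ * U = 1

/-- operator norm (largest singular value) of a matrix -/
def opNorm {A B : Type*} [Fintype A] [Fintype B] [DecidableEq B]
    (M : Matrix A B ℂ) : ℝ :=
  ‖LinearMap.toContinuousLinearMap (Matrix.toEuclideanLin M)‖

/-- trace norm: the sum of the singular values -/
def traceNorm {A B : Type*} [Fintype A] [Fintype B] [DecidableEq B]
    (M : Matrix A B ℂ) : ℝ :=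
  ∑ k, Real.sqrt ((Matrix.posSemidef_conjTranspose_mul_self M).1.eigenvalues k)

/-- matrix logarithm taken on the support (eigenvalue `0 ↦ 0`, since `Real.log 0 = 0`) -/
def mlog {n : Type*} [Fintype n] [DecidableEq n] (ρ : Matrix n n ℂ) : Matrix n n ℂ :=
  if h : ρ.IsHermitian then
    (h.eigenvectorUnitary : Matrix n n ℂ) *
      Matrix.diagonal (fun k => (Real.log (h.eigenvalues k) : ℂ)) *
      (h.eigenvectorUnitary : Matrix n n ℂ)ᴴ
  else 0

/-- quantum relative entropy D(ρ‖σ) = Tr(ρ (log ρ − log σ)) -/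
def relEnt {n : Type*} [Fintype n] [DecidableEq n] (ρ σ : Matrix n n ℂ) : ℝ :=
  ((ρ * (mlog ρ - mlog σ)).trace).re

/-- `ω^x = exp(2πi·x̃/d)` for `x : ZMod d`, where `x̃ = x.val` is the canonical representative. -/
def omegaPow (d : ℕ) [NeZero d] (x : ZMod d) : ℂ :=
  Complex.exp (2 * Real.pi * Complex.I * (x.val : ℂ) / d)

/-- The entropy of a Hermitian matrix read off the roots of its characteristic polynomial. -/
theorem vN_eq_sum_roots {n : Type*} [Fintype n] [DecidableEq n] {A : Matrix n n ℂ}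
    (hA : A.IsHermitian) :
    vN A = (A.charpoly.roots.map fun z => Real.negMulLog z.re).sum := by
  rw [vN, dif_pos hA, hA.roots_charpoly_eq_eigenvalues, Multiset.map_map,
    ← Finset.sum_neg_distrib]
  exact Finset.sum_congr rfl fun i _ => by simp [Real.negMulLog]

theorem vN_mul_comm {m n : Type*} [Fintype m] [DecidableEq m] [Fintype n] [DecidableEq n]
    {A : Matrix m n ℂ} {B : Matrix n m ℂ} (hAB : (A * B).IsHermitian)
    (hBA : (B * A).IsHermitian) : vN (A * B) = vN (B * A) := by
  have h := congrArg Polynomial.roots (Matrix.charpoly_mul_comm' A B)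
  rw [Polynomial.roots_mul ((Polynomial.monic_X_pow _).mul (charpoly_monic _)).ne_zero,
    Polynomial.roots_mul ((Polynomial.monic_X_pow _).mul (charpoly_monic _)).ne_zero] at h
  have h' := congrArg (fun s => (Multiset.map (fun z : ℂ => Real.negMulLog z.re) s).sum) h
  simpa [vN_eq_sum_roots hAB, vN_eq_sum_roots hBA, Multiset.map_nsmul, Multiset.sum_nsmul]
    using h'

/-- Conjugation by an isometry preserves the entropy. -/
theorem vN_conj_isometry {m n : Type*} [Fintype m] [DecidableEq m] [Fintype n] [DecidableEq n]
    {V : Matrix m n ℂ} (hV : Vᴴ * V = 1) {A : Matrix n n ℂ} (hA : A.IsHermitian) :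
    vN (V * A * Vᴴ) = vN A := by
  have e : Vᴴ * (V * A) = A := by rw [← Matrix.mul_assoc, hV, Matrix.one_mul]
  rw [vN_mul_comm (Matrix.isHermitian_mul_mul_conjTranspose V hA) (e.symm ▸ hA), e]

theorem vN_diagonal {n : Type*} [Fintype n] [DecidableEq n] (p : n → ℝ) :
    vN (Matrix.diagonal fun i => (p i : ℂ)) = ∑ i, Real.negMulLog (p i) := by
  rw [vN_eq_sum_roots (Matrix.isHermitian_diagonal_of_self_adjoint _ (by ext; simp)),
    Matrix.charpoly_diagonal, Polynomial.roots_prod _ _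
      (by simp [Finset.prod_ne_zero_iff, Polynomial.X_sub_C_ne_zero])]
  simp

theorem vN_eq_sum_eigenvalues {n : Type*} [Fintype n] [DecidableEq n] {A : Matrix n n ℂ}
    (hA : A.IsHermitian) : vN A = ∑ i, Real.negMulLog (hA.eigenvalues i) := by
  simp [vN, dif_pos hA, Real.negMulLog]

theorem IsDensity.sum_eigenvalues {n : Type*} [Fintype n] [DecidableEq n] {A : Matrix n n ℂ}
    (hA : IsDensity A) : ∑ i, hA.1.1.eigenvalues i = 1 := by
  have h := hA.1.1.trace_eq_sum_eigenvalues
  exact Complex.ofReal_injective (by simpa using h.symm.trans hA.2)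

theorem IsDensity.vN_nonneg {n : Type*} [Fintype n] [DecidableEq n] {A : Matrix n n ℂ}
    (hA : IsDensity A) : 0 ≤ vN A := by
  rw [vN_eq_sum_eigenvalues hA.1.1]
  refine Finset.sum_nonneg fun i _ => Real.negMulLog_nonneg (hA.1.eigenvalues_nonneg i) ?_
  rw [← hA.sum_eigenvalues]
  exact Finset.single_le_sum (fun j _ => hA.1.eigenvalues_nonneg j) (Finset.mem_univ i)

theorem IsDensity.vN_le_log_card {n : Type*} [Fintype n] [DecidableEq n] {A : Matrix n n ℂ}
    (hA : IsDensity A) : vN A ≤ Real.log (Fintype.card n) := by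
  have hs := hA.sum_eigenvalues
  have hn : Nonempty n := by
    by_contra h
    rw [not_nonempty_iff] at h
    simp at hs
  have hc : (0 : ℝ) < Fintype.card n := by exact_mod_cast Fintype.card_pos
  have h := Real.concaveOn_negMulLog.le_map_sum (t := Finset.univ)
    (w := fun _ : n => (Fintype.card n : ℝ)⁻¹) (p := hA.1.1.eigenvalues)
    (fun _ _ => by positivity) (by simp [hc.ne'])
    (fun i _ => hA.1.eigenvalues_nonneg i)
  simp only [smul_eq_mul, ← Finset.mul_sum, hs, ← vN_eq_sum_eigenvalues hA.1.1] at h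
  rw [mul_one, Real.negMulLog, Real.log_inv, neg_mul_neg] at h
  exact le_of_mul_le_mul_left h (by positivity)

open scoped Kronecker in
/-- Tensoring with the maximally mixed state adds the logarithm of its dimension. -/
theorem vN_maximallyMixed_kronecker {k n : Type*} [Fintype k] [DecidableEq k] [Nonempty k]
    [Fintype n] [DecidableEq n] {A : Matrix n n ℂ} (hA : IsDensity A) :
    vN (((Fintype.card k : ℂ)⁻¹ • (1 : Matrix k k ℂ)) ⊗ₖ A)
      = Real.log (Fintype.card k) + vN A := by
  have hc : (0 : ℝ) < Fintype.card k := by exact_mod_cast Fintype.card_pos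
  have hH := hA.1.1
  set W : Matrix n n ℂ := (hH.eigenvectorUnitary : Matrix n n ℂ) with hW
  have hWW : Wᴴ * W = 1 := Unitary.coe_star_mul_self hH.eigenvectorUnitary
  have e : ((Fintype.card k : ℂ)⁻¹ • (1 : Matrix k k ℂ)) ⊗ₖ A
      = ((1 : Matrix k k ℂ) ⊗ₖ W) *
        Matrix.diagonal (fun x : k × n =>
          (((Fintype.card k : ℝ)⁻¹ * hH.eigenvalues x.2 : ℝ) : ℂ)) *
        ((1 : Matrix k k ℂ) ⊗ₖ W)ᴴ := by
    have hD : Matrix.diagonal (fun x : k × n =>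
          (((Fintype.card k : ℝ)⁻¹ * hH.eigenvalues x.2 : ℝ) : ℂ)) =
        ((Fintype.card k : ℂ)⁻¹ • (1 : Matrix k k ℂ)) ⊗ₖ
          Matrix.diagonal (fun i => (hH.eigenvalues i : ℂ)) := by
      rw [Matrix.smul_one_eq_diagonal, Matrix.diagonal_kronecker_diagonal]
      simp
    rw [hD, Matrix.conjTranspose_kronecker, ← Matrix.mul_kronecker_mul,
      ← Matrix.mul_kronecker_mul]
    have := hH.spectral_theorem
    rw [Unitary.conjStarAlgAut_apply] at this
    conv_lhs => rw [this]
    simp [Function.comp_def, hW, Matrix.star_eq_conjTranspose]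
  rw [e, vN_conj_isometry _ (Matrix.isHermitian_diagonal_of_self_adjoint _ (by ext; simp)),
    vN_diagonal, Fintype.sum_prod_type]
  · simp only [Real.negMulLog_mul, Finset.sum_add_distrib, ← Finset.sum_mul, ← Finset.mul_sum,
      hA.sum_eigenvalues, ← vN_eq_sum_eigenvalues hH]
    simp [Real.negMulLog, Real.log_inv]
  · rw [Matrix.conjTranspose_kronecker, ← Matrix.mul_kronecker_mul, hWW]
    simp

/-- A density matrix supported in the span of an orthonormal family is the isometric image of a
density matrix on the index space. -/
theorem exists_eq_conj_of_suppIn {ι X : Type*} [Fintype ι] [DecidableEq ι] [Fintype X]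
    [DecidableEq X] {ρ : Matrix X X ℂ} (hρ : IsDensity ρ) {v : ι → X → ℂ} (hv : ONFam v)
    (hs : SuppIn ρ v) :
    ∃ σ : Matrix ι ι ℂ, IsDensity σ ∧
      ρ = (Matrix.of v)ᵀ * σ * ((Matrix.of v)ᵀ)ᴴ := by
  set V : Matrix X ι ℂ := (Matrix.of v)ᵀ with hVdef
  have hV : Vᴴ * V = 1 := by
    ext i j
    simpa [Matrix.mul_apply, Matrix.one_apply, hVdef] using hv i j
  have hcol : ∀ x, ∃ c : ι → ℂ, V *ᵥ c = ρ *ᵥ Pi.single x 1 := fun x => by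
    have h := hs ⟨Pi.single x 1, rfl⟩
    have hr : LinearMap.range V.mulVecLin = Submodule.span ℂ (Set.range v) :=
      Matrix.range_mulVecLin V
    rw [← hr] at h
    exact h
  choose c hc using hcol
  have hfac : ρ = V * (Matrix.of c)ᵀ := by
    ext y x
    have := congrFun (hc x) y
    rw [Matrix.mulVec_single_one] at this
    simpa [Matrix.mul_apply, Matrix.mulVec, dotProduct] using this.symm
  have hP : V * Vᴴ * ρ = ρ := by
    rw [hfac, Matrix.mul_assoc, ← Matrix.mul_assoc Vᴴ, hV, Matrix.one_mul]
  have hP' : ρ * (V * Vᴴ) = ρ := by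
    have := congrArg Matrix.conjTranspose hP
    rwa [Matrix.conjTranspose_mul, hρ.1.1.eq, Matrix.conjTranspose_mul,
      Matrix.conjTranspose_conjTranspose] at this
  refine ⟨Vᴴ * ρ * V, ⟨hρ.1.conjTranspose_mul_mul_same V, ?_⟩, ?_⟩
  · rw [Matrix.mul_assoc, Matrix.trace_mul_comm, Matrix.mul_assoc, hP', hρ.2]
  · calc ρ = V * Vᴴ * ρ * (V * Vᴴ) := by rw [hP, hP']
      _ = _ := by simp only [Matrix.mul_assoc]

theorem sqrt_inv_mul_self (d : ℕ) :
    (Real.sqrt d : ℂ)⁻¹ * (Real.sqrt d : ℂ)⁻¹ = (d : ℂ)⁻¹ := by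
  rw [← mul_inv, ← Complex.ofReal_mul, Real.mul_self_sqrt (Nat.cast_nonneg d),
    Complex.ofReal_natCast]

/-- The normalised characters `ω^{ic} / √d` form an orthonormal basis. -/
theorem sum_omegaPow_mul_star (d : ℕ) [NeZero d] (i j : ZMod d) :
    ∑ c, ((Real.sqrt d : ℂ)⁻¹ * omegaPow d (i * c)) *
      star ((Real.sqrt d : ℂ)⁻¹ * omegaPow d (j * c)) = if i = j then 1 else 0 := by
  have ho : ∀ x, omegaPow d x = ZMod.stdAddChar x := fun x => by
    rw [ZMod.stdAddChar_apply, ZMod.toCircle_apply, omegaPow]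
  have hd : (d : ℂ) ≠ 0 := by exact_mod_cast NeZero.ne d
  have hterm : ∀ c, ((Real.sqrt d : ℂ)⁻¹ * omegaPow d (i * c)) *
      star ((Real.sqrt d : ℂ)⁻¹ * omegaPow d (j * c))
      = (d : ℂ)⁻¹ * ZMod.stdAddChar (c * (i - j)) := fun c => by
    have hneg : star (ZMod.stdAddChar (N := d) (j * c)) = ZMod.stdAddChar (-(j * c)) := by
      rw [AddChar.map_neg_eq_conj]; rfl
    rw [ho, ho, star_mul', hneg, mul_mul_mul_comm, ← AddChar.map_add_eq_mul, ← sqrt_inv_mul_self]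
    simp only [star_inv₀, Complex.star_def, Complex.conj_ofReal]
    congr 2
    ring
  rw [Finset.sum_congr rfl fun c _ => hterm c, ← Finset.mul_sum,
    AddChar.sum_mulShift _ (ZMod.isPrimitive_stdAddChar d)]
  simp only [sub_eq_zero, ZMod.card]
  split_ifs <;> simp [hd]

/-! ### Marginals of the code states

In the bases `F` and `|b, c⟩`, a code state has entries
`d⁻¹ σ(a - b, a' - b') F c (a - b) conj (F c' (a' - b'))`, where `σ` is the logical state. -/

section marginals
variable {d : ℕ} [NeZero d] {F : ZMod d → ZMod d → ℂ} {σ : Matrix (ZMod d) (ZMod d) ℂ}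
  {ρ : Matrix (ZMod d × ZMod d × ZMod d) (ZMod d × ZMod d × ZMod d) ℂ}

theorem sum_sub_left (g : ZMod d → ℂ) (a : ZMod d) : ∑ b, g (a - b) = ∑ i, g i :=
  (Equiv.subLeft a).sum_comp g

theorem sum_sub_right (g : ZMod d → ℂ) (b : ZMod d) : ∑ a, g (a - b) = ∑ i, g i :=
  (Equiv.subRight b).sum_comp g

theorem vN_maximallyMixed (d : ℕ) [NeZero d] :
    vN ((d : ℂ)⁻¹ • (1 : Matrix (ZMod d) (ZMod d) ℂ)) = Real.log d := by
  have hd : (d : ℝ) ≠ 0 := by exact_mod_cast NeZero.ne d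
  have h := vN_diagonal fun _ : ZMod d => (d : ℝ)⁻¹
  rw [Matrix.smul_one_eq_diagonal]
  push_cast at h
  rw [h]
  simp [Real.negMulLog, Real.log_inv, ZMod.card, hd]

theorem vN_red1 (hF : ∀ i j, ∑ c, F c i * star (F c j) = if i = j then 1 else 0)
    (hσ : IsDensity σ) (hρ : ∀ a b c a' b' c', ρ (a, b, c) (a', b', c')
      = (d : ℂ)⁻¹ * σ (a - b) (a' - b') * (F c (a - b) * star (F c' (a' - b')))) :
    vN (red1 ρ) = Real.log d := by
  rw [← vN_maximallyMixed d]
  congr 1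
  ext a a'
  simp only [red1, Matrix.of_apply, hρ, ← Finset.mul_sum, hF, Matrix.smul_apply,
    Matrix.one_apply, smul_eq_mul, sub_left_inj]
  by_cases h : a = a'
  · subst h
    simp only [if_true, mul_one, ← Finset.mul_sum]
    rw [sum_sub_left (fun i => σ i i) a]
    exact (congrArg _ hσ.2).trans (mul_one _)
  · simp [h]

theorem vN_red2 (hF : ∀ i j, ∑ c, F c i * star (F c j) = if i = j then 1 else 0)
    (hσ : IsDensity σ) (hρ : ∀ a b c a' b' c', ρ (a, b, c) (a', b', c')
      = (d : ℂ)⁻¹ * σ (a - b) (a' - b') * (F c (a - b) * star (F c' (a' - b')))) :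
    vN (red2 ρ) = Real.log d := by
  rw [← vN_maximallyMixed d]
  congr 1
  ext b b'
  simp only [red2, Matrix.of_apply, hρ, ← Finset.mul_sum, hF, Matrix.smul_apply,
    Matrix.one_apply, smul_eq_mul, sub_right_inj]
  by_cases h : b = b'
  · subst h
    simp only [if_true, mul_one, ← Finset.mul_sum]
    rw [sum_sub_right (fun i => σ i i) b]
    exact (congrArg _ hσ.2).trans (mul_one _)
  · simp [h]

theorem isHermitian_diagonal_diag {n : Type*} [DecidableEq n] {A : Matrix n n ℂ}
    (hA : A.IsHermitian) : (Matrix.diagonal fun i => A i i).IsHermitian :=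
  Matrix.isHermitian_diagonal_of_self_adjoint _ (funext fun i => hA.apply i i)

theorem vN_red3 (hF : ∀ i j, ∑ c, F c i * star (F c j) = if i = j then 1 else 0)
    (hσ : IsDensity σ) (hρ : ∀ a b c a' b' c', ρ (a, b, c) (a', b', c')
      = (d : ℂ)⁻¹ * σ (a - b) (a' - b') * (F c (a - b) * star (F c' (a' - b')))) :
    vN (red3 ρ) = vN (Matrix.diagonal fun i => σ i i) := by
  have hd : (d : ℂ) ≠ 0 := by exact_mod_cast NeZero.ne d
  rw [← vN_conj_isometry (V := Matrix.of F) _ (isHermitian_diagonal_diag hσ.1.1)]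
  · congr 1
    ext c c'
    simp only [red3, Matrix.of_apply, hρ]
    rw [Finset.sum_congr rfl fun a _ =>
      sum_sub_left (fun i => (d : ℂ)⁻¹ * σ i i * (F c i * star (F c' i))) a]
    simp only [Finset.sum_const, Finset.card_univ, ZMod.card, nsmul_eq_mul, Finset.mul_sum,
      Matrix.mul_apply (M := Matrix.of F * _), Matrix.mul_diagonal,
      Matrix.conjTranspose_apply, Matrix.of_apply]
    refine Finset.sum_congr rfl fun i _ => ?_
    field_simp
  · ext i j
    simp only [Matrix.mul_apply, Matrix.conjTranspose_apply, Matrix.of_apply, Matrix.one_apply]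
    simp only [mul_comm (star _), hF, eq_comm]

theorem vN_red12 (hF : ∀ i j, ∑ c, F c i * star (F c j) = if i = j then 1 else 0)
    (hσ : IsDensity σ) (hρ : ∀ a b c a' b' c', ρ (a, b, c) (a', b', c')
      = (d : ℂ)⁻¹ * σ (a - b) (a' - b') * (F c (a - b) * star (F c' (a' - b')))) :
    vN (red12 ρ) = vN (Matrix.diagonal fun i => σ i i) := by
  have hd : (d : ℂ) ≠ 0 := by exact_mod_cast NeZero.ne d
  have hs := sqrt_inv_mul_self d
  set s : ℂ := (Real.sqrt d : ℂ)⁻¹ with hsdef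
  have hss : star s = s := by simp [hsdef]
  rw [← vN_conj_isometry
    (V := Matrix.of fun (x : ZMod d × ZMod d) i => if x.1 - x.2 = i then s else 0) _
    (isHermitian_diagonal_diag hσ.1.1)]
  · congr 1
    ext ⟨a, b⟩ ⟨a', b'⟩
    simp only [red12, Matrix.of_apply, hρ, ← Finset.mul_sum, hF,
      Matrix.mul_apply (M := Matrix.of _ * _), Matrix.mul_diagonal,
      Matrix.conjTranspose_apply]
    simp only [apply_ite star, hss, star_zero, ite_mul, zero_mul, mul_ite, mul_zero,
      Finset.sum_ite_eq, Finset.mem_univ, if_true, mul_one]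
    by_cases h : a - b = a' - b'
    · simp only [h, if_true, ← hs]
      ring
    · simp [h]
  · ext i j
    simp only [Matrix.mul_apply, Matrix.conjTranspose_apply, Matrix.of_apply, Matrix.one_apply,
      Fintype.sum_prod_type]
    rw [Finset.sum_congr rfl fun a _ =>
      sum_sub_left (fun k => star (if k = i then s else 0) * (if k = j then s else 0)) a]
    simp only [apply_ite star, hss, star_zero, ite_mul, zero_mul, Finset.sum_ite_eq',
      Finset.mem_univ, if_true, mul_ite, mul_zero, hs]
    rcases eq_or_ne i j with h | h
    · simp [h, ZMod.card, hd]
    · simp [h, h.symm]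

open scoped Kronecker in
theorem vN_red13 (hF : ∀ i j, ∑ c, F c i * star (F c j) = if i = j then 1 else 0)
    (hσ : IsDensity σ) (hρ : ∀ a b c a' b' c', ρ (a, b, c) (a', b', c')
      = (d : ℂ)⁻¹ * σ (a - b) (a' - b') * (F c (a - b) * star (F c' (a' - b')))) :
    vN (red13 ρ) = Real.log d + vN σ := by
  have h := vN_maximallyMixed_kronecker (k := ZMod d) hσ
  rw [ZMod.card] at h
  have hH : (((d : ℂ)⁻¹ • (1 : Matrix (ZMod d) (ZMod d) ℂ)) ⊗ₖ σ).IsHermitian := by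
    rw [Matrix.IsHermitian, Matrix.conjTranspose_kronecker, hσ.1.1.eq]
    simp
  rw [← h, ← vN_conj_isometry (V := Matrix.of fun (x y : ZMod d × ZMod d) =>
    if x.1 - y.1 = y.2 then F x.2 y.2 else 0) _ hH]
  · congr 1
    ext ⟨a, c⟩ ⟨a', c'⟩
    simp only [red13, Matrix.of_apply, hρ, Matrix.mul_apply, Fintype.sum_prod_type,
      Matrix.conjTranspose_apply, Matrix.kroneckerMap_apply, Matrix.smul_apply,
      Matrix.one_apply, smul_eq_mul, apply_ite star, star_zero, ite_mul, zero_mul, mul_ite,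
      mul_zero, mul_one, Finset.sum_ite_eq, Finset.mem_univ, if_true]
    refine Finset.sum_congr rfl fun k _ => ?_
    rw [Finset.sum_comm]
    simp only [Finset.sum_ite_eq', Finset.sum_ite_eq, Finset.mem_univ, if_true]
    ring
  · ext ⟨k, i⟩ ⟨k', i'⟩
    have hF' : ∀ i j, ∑ c, star (F c i) * F c j = if j = i then 1 else 0 := fun i j => by
      simpa only [mul_comm] using hF j i
    have h1 : ∀ a : ZMod d, ∑ c, star (if a - k = i then F c i else 0) *
        (if a - k' = i' then F c i' else 0)
        = if a = i + k then (if (k, i) = (k', i') then 1 else 0) else 0 := fun a => by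
      by_cases h1 : a - k = i <;> by_cases h2 : a - k' = i' <;>
        simp only [h1, h2, if_true, if_false, hF', star_zero, mul_zero, zero_mul,
          Finset.sum_const_zero] <;> grind
    simp only [Matrix.mul_apply, Matrix.conjTranspose_apply, Matrix.of_apply, Matrix.one_apply,
      Fintype.sum_prod_type, h1, Finset.sum_ite_eq', Finset.mem_univ, if_true]

open scoped Kronecker in
theorem vN_red23 (hF : ∀ i j, ∑ c, F c i * star (F c j) = if i = j then 1 else 0)
    (hσ : IsDensity σ) (hρ : ∀ a b c a' b' c', ρ (a, b, c) (a', b', c')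
      = (d : ℂ)⁻¹ * σ (a - b) (a' - b') * (F c (a - b) * star (F c' (a' - b')))) :
    vN (red23 ρ) = Real.log d + vN σ := by
  have h := vN_maximallyMixed_kronecker (k := ZMod d) hσ
  rw [ZMod.card] at h
  have hH : (((d : ℂ)⁻¹ • (1 : Matrix (ZMod d) (ZMod d) ℂ)) ⊗ₖ σ).IsHermitian := by
    rw [Matrix.IsHermitian, Matrix.conjTranspose_kronecker, hσ.1.1.eq]
    simp
  rw [← h, ← vN_conj_isometry (V := Matrix.of fun (x y : ZMod d × ZMod d) =>
    if y.1 - x.1 = y.2 then F x.2 y.2 else 0) _ hH]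
  · congr 1
    ext ⟨b, c⟩ ⟨b', c'⟩
    simp only [red23, Matrix.of_apply, hρ, Matrix.mul_apply, Fintype.sum_prod_type,
      Matrix.conjTranspose_apply, Matrix.kroneckerMap_apply, Matrix.smul_apply,
      Matrix.one_apply, smul_eq_mul, apply_ite star, star_zero, ite_mul, zero_mul, mul_ite,
      mul_zero, mul_one, Finset.sum_ite_eq, Finset.mem_univ, if_true]
    refine Finset.sum_congr rfl fun k _ => ?_
    rw [Finset.sum_comm]
    simp only [Finset.sum_ite_eq', Finset.sum_ite_eq, Finset.mem_univ, if_true]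
    ring
  · ext ⟨k, i⟩ ⟨k', i'⟩
    have hF' : ∀ i j, ∑ c, star (F c i) * F c j = if j = i then 1 else 0 := fun i j => by
      simpa only [mul_comm] using hF j i
    have h1 : ∀ b : ZMod d, ∑ c, star (if k - b = i then F c i else 0) *
        (if k' - b = i' then F c i' else 0)
        = if b = k - i then (if (k, i) = (k', i') then 1 else 0) else 0 := fun b => by
      by_cases h1 : k - b = i <;> by_cases h2 : k' - b = i' <;>
        simp only [h1, h2, if_true, if_false, hF', star_zero, mul_zero, zero_mul,
          Finset.sum_const_zero] <;> grind
    simp only [Matrix.mul_apply, Matrix.conjTranspose_apply, Matrix.of_apply, Matrix.one_apply,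
      Fintype.sum_prod_type, h1, Finset.sum_ite_eq', Finset.mem_univ, if_true]

end marginals


/-- for the code space of the VIP tensor `t(i,j,k,l) = d^{-1/2} ω^{il} [j = i+k]`,
every density matrix `ρ̃` supported in it satisfies `I(R:P3)(ρ̃) ≤ log d` and
`−2 S(ρ̃) ≤ I₃(ρ̃) ≤ −2 S(ρ̃) + log d`. -/
theorem stmt19 (d : ℕ) [NeZero d]
    (t : ZMod d → ZMod d → ZMod d → ZMod d → ℂ)
    (ht : ∀ i j k l, t i j k l =
        if j = i + k then (Real.sqrt d : ℂ)⁻¹ * omegaPow d (i * l) else 0)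
    (v : ZMod d → (ZMod d × ZMod d × ZMod d) → ℂ)
    (hv : ∀ i x, v i x = (Real.sqrt d : ℂ)⁻¹ * t i x.1 x.2.1 x.2.2)
    (ρ : Matrix (ZMod d × ZMod d × ZMod d) (ZMod d × ZMod d × ZMod d) ℂ)
    (hρ : IsDensity ρ) (hsupp : SuppIn ρ v) :
    (vN ρ + vN (red3 ρ) - vN (red12 ρ) ≤ Real.log d) ∧
    (-2 * vN ρ ≤ I3 ρ ∧ I3 ρ ≤ -2 * vN ρ + Real.log d) := by
  have hd : (d : ℂ) ≠ 0 := by exact_mod_cast NeZero.ne d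
  have hs := sqrt_inv_mul_self d
  have hF := sum_omegaPow_mul_star d
  have hvF : ∀ i a b c, v i (a, b, c) = if a - b = i then
      (Real.sqrt d : ℂ)⁻¹ * ((Real.sqrt d : ℂ)⁻¹ * omegaPow d (i * c)) else 0 := fun i a b c => by
    simp only [hv, ht, mul_ite, mul_zero, sub_eq_iff_eq_add]
  obtain ⟨F, hFdef⟩ : ∃ F : ZMod d → ZMod d → ℂ,
    F = fun c i => (Real.sqrt d : ℂ)⁻¹ * omegaPow d (i * c) := ⟨_, rfl⟩
  have hF' : ∀ i j, ∑ c, F c i * star (F c j) = if i = j then 1 else 0 := by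
    simpa only [hFdef] using hF
  have hvF' : ∀ i a b c, v i (a, b, c) =
      if a - b = i then (Real.sqrt d : ℂ)⁻¹ * F c i else 0 := by
    simpa only [hFdef] using hvF
  clear hF hvF hFdef
  set s : ℂ := (Real.sqrt d : ℂ)⁻¹ with hsdef
  have hss : star s = s := by simp [hsdef]
  have hON : ONFam v := fun i j => by
    have h1 : ∀ a b, ∑ c, star (v i (a, b, c)) * v j (a, b, c)
        = if a - b = i then (if i = j then (d : ℂ)⁻¹ else 0) else 0 := fun a b => by
      have h2 : ∀ c, star (v i (a, b, c)) * v j (a, b, c)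
          = if a - b = i then (if i = j then (d : ℂ)⁻¹ * (F c j * star (F c i)) else 0)
            else 0 := fun c => by
        rw [hvF', hvF', ← hs]
        by_cases h1 : a - b = i
        · subst h1
          rw [if_pos rfl, if_pos rfl, star_mul', hss]
          split_ifs
          · ring
          · simp
        · simp [h1]
      simp only [h2]
      split_ifs with h3 h4
      · rw [← Finset.mul_sum, hF', if_pos h4.symm, mul_one]
      · simp
      · simp
    simp only [Fintype.sum_prod_type, h1]
    rw [Finset.sum_congr rfl fun a _ =>
      sum_sub_left (fun k => if k = i then (if i = j then (d : ℂ)⁻¹ else 0) else 0) a]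
    simp only [Finset.sum_ite_eq', Finset.mem_univ, if_true]
    split_ifs <;> simp [ZMod.card, hd]
  obtain ⟨σ, hσ, hρσ⟩ := exists_eq_conj_of_suppIn hρ hON hsupp
  have hent : ∀ a b c a' b' c', ρ (a, b, c) (a', b', c')
      = (d : ℂ)⁻¹ * σ (a - b) (a' - b') * (F c (a - b) * star (F c' (a' - b'))) := by
    intro a b c a' b' c'
    rw [hρσ]
    simp only [Matrix.mul_apply, Matrix.conjTranspose_apply, Matrix.transpose_apply,
      Matrix.of_apply, hvF', apply_ite star, star_zero, ite_mul, zero_mul, mul_ite, mul_zero,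
      Finset.sum_ite_eq, Finset.mem_univ, if_true, star_mul', hss, ← hs]
    ring
  have hS : vN ρ = vN σ := by
    rw [hρσ]
    refine vN_conj_isometry ?_ hσ.1.1
    ext i j
    simpa [Matrix.mul_apply, Matrix.one_apply] using hON i j
  have h0 := hσ.vN_nonneg
  have hlog := hσ.vN_le_log_card
  rw [ZMod.card] at hlog
  rw [I3, vN_red1 hF' hσ hent, vN_red2 hF' hσ hent, vN_red3 hF' hσ hent,
    vN_red12 hF' hσ hent, vN_red13 hF' hσ hent, vN_red23 hF' hσ hent, hS]
  exact ⟨by linarith, by linarith, by linarith⟩
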